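/- Let β : ℝ → [0,∞) be bounded, even, integrable, decreasing on [0,∞), and satisfy β(2^j x) ≤ 2^{4−j} β(x) for all |x| ≥ 1 and all integers j ≥ 0. Then for every p with 1 ≤ p < ∞ there is a constant C = C(p, β) such that the following holds: for every λ > 0, every family {I_{rl}}_{(r,l)∈S} of dyadic intervals with pairwise disjoint interiors, and every choice of nonnegative coefficients c_{rl} with 2^r c_{rl} ≤ 2λ for all (r,l) ∈ S, one has ‖ Σ_{(r,l)∈S} 2^r c_{rl} β(2^r · − l) ‖_{L^p(ℝ)} ≤ C λ^{1−1/p} ( Σ_{(r,l)∈S} c_{rl} )^{1/p}. -/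

import Mathlib

open MeasureTheory Set Filter
open scoped ENNReal Topology

noncomputable section

/-- The dyadic interval `I_{rl} = [2^{-r} l, 2^{-r}(l+1)]`. -/
def Idy (r l : ℤ) : Set ℝ := Icc ((2 : ℝ) ^ (-r) * l) ((2 : ℝ) ^ (-r) * (l + 1))

/-- The assumptions on `β`: nonnegative, bounded, even, integrable, decreasing on `[0, ∞)`,
and `β(2^j x) ≤ 2^{4-j} β(x)` for `|x| ≥ 1` and integers `j ≥ 0`. -/
def BetaHyp (β : ℝ → ℝ) : Prop :=
  (∀ x, 0 ≤ β x) ∧ (∃ M : ℝ, ∀ x, β x ≤ M) ∧ (∀ x, β (-x) = β x) ∧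
  Integrable β volume ∧ AntitoneOn β (Ici 0) ∧
  (∀ (j : ℕ) (x : ℝ), 1 ≤ |x| → β ((2 : ℝ) ^ j * x) ≤ (2 : ℝ) ^ ((4 : ℤ) - j) * β x)

theorem ENNReal.add_pow_succ_le (a b : ℝ≥0∞) (n : ℕ) :
    (a + b) ^ (n + 1) ≤ a ^ (n + 1) + (n + 1) * (b * (a + b) ^ n) := by
  induction n with
  | zero => simp
  | succ n ih =>
    calc (a + b) ^ (n + 1 + 1) = (a + b) ^ (n + 1) * a + b * (a + b) ^ (n + 1) := by ring
      _ ≤ (a ^ (n + 1) + (n + 1) * (b * (a + b) ^ n)) * a + b * (a + b) ^ (n + 1) := by gcongr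
      _ = a ^ (n + 1 + 1) + ((n + 1) * (b * ((a + b) ^ n * a)) + b * (a + b) ^ (n + 1)) := by ring
      _ ≤ a ^ (n + 1 + 1) +
          ((n + 1) * (b * ((a + b) ^ n * (a + b))) + b * (a + b) ^ (n + 1)) := by
        gcongr
        exact le_self_add
      _ = a ^ (n + 1 + 1) + ((n + 1 : ℕ) + 1) * (b * (a + b) ^ (n + 1)) := by
        push_cast; ring

theorem Finset.sum_pow_succ_le_sum_mul_pow {ι α : Type*} [LinearOrder α] (ρ : ι → α)
    (x : ι → ℝ≥0∞) (n : ℕ) (s : Finset ι) :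
    (∑ i ∈ s, x i) ^ (n + 1) ≤
      (n + 1) * ∑ i ∈ s, x i * (∑ j ∈ s, {j | ρ j ≤ ρ i}.indicator x j) ^ n := by
  classical
  induction s using Finset.induction_on_max_value ρ with
  | empty => simp
  | insert a s has hmax ih =>
    rw [Finset.sum_insert has, add_comm, Finset.sum_insert has, mul_add, add_comm (_ * _)]
    refine (ENNReal.add_pow_succ_le _ _ _).trans (add_le_add (ih.trans ?_) ?_)
    · gcongr
      exact Finset.subset_insert _ _
    · gcongr
      rw [Finset.sum_insert has, add_comm]
      refine add_le_add (by simp) (Finset.sum_le_sum fun j hj => ?_)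
      rw [indicator_of_mem (by exact hmax j hj)]

theorem ENNReal.tsum_pow_succ_le_tsum_mul_pow {ι α : Type*} [LinearOrder α] (ρ : ι → α)
    (x : ι → ℝ≥0∞) (n : ℕ) :
    (∑' i, x i) ^ (n + 1) ≤
      (n + 1) * ∑' i, x i * (∑' j, {j | ρ j ≤ ρ i}.indicator x j) ^ n := by
  refine le_of_tendsto
    (((ENNReal.continuous_pow (n + 1)).tendsto _).comp (ENNReal.summable (f := x)).hasSum) ?_
  refine Eventually.of_forall fun s => ?_
  refine (Finset.sum_pow_succ_le_sum_mul_pow ρ x n s).trans ?_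
  gcongr
  refine (Finset.sum_le_sum fun i _ => ?_).trans (ENNReal.sum_le_tsum s)
  gcongr
  exact ENNReal.sum_le_tsum s

/-- Moment bound for a sum of weighted indicators, given a Carleson-type packing condition: the
total mass `m` of the sets that meet `J i` and are no larger than it is controlled by `m i / w i`. -/
theorem lintegral_tsum_indicator_pow_le {X ι α : Type*} [MeasurableSpace X] {μ : Measure X}
    [Countable ι] [LinearOrder α] (ρ : ι → α) {J : ι → Set X} (hJ : ∀ i, MeasurableSet (J i))
    (D : ℝ≥0∞) (n : ℕ) (w m : ι → ℝ≥0∞) (hw : ∀ i, w i * μ (J i) ≤ m i)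
    (hD : ∀ i, w i * ∑' j, {j | ρ j ≤ ρ i ∧ (J j ∩ J i).Nonempty}.indicator m j ≤ D * m i) :
    ∫⁻ t, (∑' i, (J i).indicator (fun _ => w i) t) ^ (n + 1) ∂μ ≤
      (n + 1).factorial * D ^ n * ∑' i, m i := by
  have hmeas : ∀ v : ι → ℝ≥0∞, Measurable fun t => ∑' i, (J i).indicator (fun _ => v i) t :=
    fun v => Measurable.tsum fun i => measurable_const.indicator (hJ i)
  induction n generalizing w m with
  | zero =>
    simp only [zero_add, pow_one, Nat.factorial_one, Nat.cast_one, pow_zero, one_mul]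
    rw [lintegral_tsum fun i => (measurable_const.indicator (hJ i)).aemeasurable]
    refine ENNReal.tsum_le_tsum fun i => ?_
    rw [lintegral_indicator_const (hJ i)]
    exact hw i
  | succ n ih =>
    set N : ι → Set ι := fun i => {j | ρ j ≤ ρ i ∧ (J j ∩ J i).Nonempty} with hN
    have key : ∀ i, w i * ∫⁻ t, (∑' j, (J j).indicator (fun _ => (N i).indicator w j) t) ^ (n + 1)
        ∂μ ≤ (n + 1).factorial * D ^ (n + 1) * m i := by
      intro i
      have h1 := ih ((N i).indicator w) ((N i).indicator m) (fun k => ?_) (fun k => ?_)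
      · calc _ ≤ w i * ((n + 1).factorial * D ^ n * ∑' j, (N i).indicator m j) := by gcongr
          _ = (n + 1).factorial * D ^ n * (w i * ∑' j, (N i).indicator m j) := by ring
          _ ≤ (n + 1).factorial * D ^ n * (D * m i) := mul_le_mul_right (hD i) _
          _ = _ := by ring
      · by_cases hk : k ∈ N i
        · simpa [hk] using hw k
        · simp [hk]
      · by_cases hk : k ∈ N i
        · simp only [indicator_of_mem hk]
          refine le_trans ?_ (hD k)
          gcongr with j
          exact indicator_le_self _ _ _
        · simp [hk]
    calc ∫⁻ t, (∑' i, (J i).indicator (fun _ => w i) t) ^ (n + 1 + 1) ∂μ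
        ≤ ∫⁻ t, ((n + 1 : ℕ) + 1) * ∑' i, w i *
            (∑' j, (J j).indicator (fun _ => (N i).indicator w j) t) ^ (n + 1) ∂μ := by
          refine lintegral_mono fun t => ?_
          refine (ENNReal.tsum_pow_succ_le_tsum_mul_pow ρ _ (n + 1)).trans ?_
          refine mul_le_mul_right (ENNReal.tsum_le_tsum fun i => ?_) _
          by_cases ht : t ∈ J i
          · rw [indicator_of_mem ht]
            refine mul_le_mul_right (pow_le_pow_left' (ENNReal.tsum_le_tsum fun j => ?_) _) _
            by_cases hj : t ∈ J j
            · by_cases hr : ρ j ≤ ρ i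
              · have : j ∈ N i := ⟨hr, t, hj, ht⟩
                simp [hj, this, hr]
              · simp [hr]
            · simp [indicator_apply, hj]
          · simp [ht]
      _ = ((n + 1 : ℕ) + 1) * ∑' i, w i *
            ∫⁻ t, (∑' j, (J j).indicator (fun _ => (N i).indicator w j) t) ^ (n + 1) ∂μ := by
          rw [lintegral_const_mul _
            (Measurable.tsum fun i => ((hmeas _).pow_const _).const_mul _),
            lintegral_tsum fun i => (((hmeas _).pow_const _).const_mul _).aemeasurable]
          simp_rw [lintegral_const_mul _ ((hmeas _).pow_const _)]
      _ ≤ ((n + 1 : ℕ) + 1) * ∑' i, (n + 1).factorial * D ^ (n + 1) * m i := by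
          exact mul_le_mul_right (ENNReal.tsum_le_tsum key) _
      _ = _ := by
          rw [ENNReal.tsum_mul_left, Nat.factorial_succ (n + 1)]
          push_cast
          ring

theorem ENNReal.rpow_le_mul_add_mul_pow {lam x : ℝ≥0∞} (h0 : lam ≠ 0) (ht : lam ≠ ∞) {p : ℝ}
    (hp : 1 ≤ p) {n : ℕ} (hn : p ≤ n) :
    x ^ p ≤ lam ^ (p - 1) * x + lam ^ (p - n) * x ^ n := by
  rcases le_total x lam with h | h
  · refine le_trans ?_ le_self_add
    calc x ^ p = x ^ ((p - 1) + 1) := by ring_nf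
      _ = x ^ (p - 1) * x := by
        rw [ENNReal.rpow_add_of_nonneg _ _ (by linarith) zero_le_one, ENNReal.rpow_one]
      _ ≤ _ := by gcongr
  · refine le_trans ?_ le_add_self
    calc x ^ p = lam ^ ((p - n) + (n - p)) * x ^ p := by simp
      _ = lam ^ (p - n) * (lam ^ (n - p) * x ^ p) := by rw [ENNReal.rpow_add _ _ h0 ht, mul_assoc]
      _ ≤ lam ^ (p - n) * (x ^ (n - p) * x ^ p) := by gcongr
      _ = _ := by
        rw [← ENNReal.rpow_add_of_nonneg _ _ (by linarith) (by linarith), sub_add_cancel,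
          ENNReal.rpow_natCast]

theorem ENNReal.tsum_mul_rpow_le {ι : Type*} (b f : ι → ℝ≥0∞) {p : ℝ} (hp : 1 ≤ p) :
    (∑' i, b i * f i) ^ p ≤ (∑' i, b i) ^ (p - 1) * ∑' i, b i * f i ^ p := by
  refine le_of_tendsto
    ((ENNReal.continuous_rpow_const (y := p)).tendsto _ |>.comp
      (ENNReal.summable (f := fun i => b i * f i)).hasSum) ?_
  refine Eventually.of_forall fun s => ?_
  have h := ENNReal.inner_le_weight_mul_Lp_of_nonneg s hp b f
  have hp0 : 0 < p := by linarith
  calc (∑ i ∈ s, b i * f i) ^ p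
      ≤ ((∑ i ∈ s, b i) ^ (1 - p⁻¹) * (∑ i ∈ s, b i * f i ^ p) ^ p⁻¹) ^ p := by gcongr
    _ = (∑ i ∈ s, b i) ^ (p - 1) * ∑ i ∈ s, b i * f i ^ p := by
      rw [ENNReal.mul_rpow_of_nonneg _ _ hp0.le, ← ENNReal.rpow_mul, ← ENNReal.rpow_mul,
        inv_mul_cancel₀ hp0.ne', ENNReal.rpow_one, sub_mul, inv_mul_cancel₀ hp0.ne', one_mul]
    _ ≤ _ := by
      gcongr <;> exact ENNReal.sum_le_tsum s

theorem setOf_abs_zpow_mul_sub_lt (r l : ℤ) (R : ℝ) :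
    {t : ℝ | |(2 : ℝ) ^ r * t - l| < R} = Metric.ball ((2 : ℝ) ^ (-r) * l) (R * 2 ^ (-r)) := by
  have h2 : (0 : ℝ) < 2 ^ r := by positivity
  ext t
  have : (2 : ℝ) ^ r * t - l = 2 ^ r * (t - 2 ^ (-r) * l) := by
    rw [zpow_neg]; field_simp
  rw [mem_ofPred_eq, Metric.mem_ball, Real.dist_eq, this, abs_mul, abs_of_pos h2, zpow_neg,
    ← div_eq_mul_inv, lt_div_iff₀ h2, mul_comm]

theorem volume_interior_Idy (r l : ℤ) :
    volume (interior (Idy r l)) = ENNReal.ofReal (2 ^ (-r)) := by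
  rw [Idy, interior_Icc, Real.volume_Ioo]
  ring_nf

theorem tsum_coeff_neighbours_le {R : ℝ} (hR : 1 ≤ R) {lam : ℝ} (hlam : 0 < lam)
    {S : Set (ℤ × ℤ)}
    (hS : S.Pairwise fun q q' =>
        Disjoint (interior (Idy q.1 q.2)) (interior (Idy q'.1 q'.2)))
    {c : ℤ × ℤ → ℝ} (hc' : ∀ q ∈ S, (2 : ℝ) ^ q.1 * c q ≤ 2 * lam) (i : S) :
    ∑' j : S, {j : S | -(j : ℤ × ℤ).1 ≤ -(i : ℤ × ℤ).1 ∧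
      (Metric.ball ((2 : ℝ) ^ (-(j : ℤ × ℤ).1) * (j : ℤ × ℤ).2) (R * 2 ^ (-(j : ℤ × ℤ).1)) ∩
       Metric.ball ((2 : ℝ) ^ (-(i : ℤ × ℤ).1) * (i : ℤ × ℤ).2)
        (R * 2 ^ (-(i : ℤ × ℤ).1))).Nonempty}.indicator
          (fun j : S => ENNReal.ofReal (2 * c j)) j ≤
      ENNReal.ofReal (24 * lam * (R * 2 ^ (-(i : ℤ × ℤ).1))) := by
  set N := {j : S | -(j : ℤ × ℤ).1 ≤ -(i : ℤ × ℤ).1 ∧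
      (Metric.ball ((2 : ℝ) ^ (-(j : ℤ × ℤ).1) * (j : ℤ × ℤ).2) (R * 2 ^ (-(j : ℤ × ℤ).1)) ∩
       Metric.ball ((2 : ℝ) ^ (-(i : ℤ × ℤ).1) * (i : ℤ × ℤ).2)
        (R * 2 ^ (-(i : ℤ × ℤ).1))).Nonempty} with hN
  let U : S → Set ℝ := fun j => interior (Idy (j : ℤ × ℤ).1 (j : ℤ × ℤ).2)
  rw [← tsum_subtype N (fun j : S => ENNReal.ofReal (2 * c j))]
  have h1 : ∀ j : N, ENNReal.ofReal (2 * c j) ≤ ENNReal.ofReal (4 * lam) * volume (U j) := by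
    rintro ⟨⟨j, hj⟩, -⟩
    have h2 : (0 : ℝ) < 2 ^ j.1 := by positivity
    rw [volume_interior_Idy, ← ENNReal.ofReal_mul (by positivity), zpow_neg]
    apply ENNReal.ofReal_le_ofReal
    rw [← div_eq_mul_inv, le_div_iff₀ h2]
    linarith [hc' j hj]
  have h3 : ∑' j : N, volume (U j) ≤ volume (⋃ j : N, U j) := by
    refine le_of_eq (measure_iUnion (fun j k hjk => ?_) fun j => isOpen_interior.measurableSet).symm
    refine hS (j : S).2 (k : S).2 fun h => hjk ?_
    exact Subtype.ext (Subtype.ext h)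
  have h4 : (⋃ j : N, U j) ⊆ Metric.ball ((2 : ℝ) ^ (-(i : ℤ × ℤ).1) * (i : ℤ × ℤ).2)
      (3 * (R * 2 ^ (-(i : ℤ × ℤ).1))) := by
    refine iUnion_subset ?_
    rintro ⟨j, hle, s, hsj, hsi⟩ u hu
    have hpow : (2 : ℝ) ^ (-(j : ℤ × ℤ).1) ≤ 2 ^ (-(i : ℤ × ℤ).1) :=
      zpow_le_zpow_right₀ one_le_two hle
    have hpos : (0 : ℝ) < 2 ^ (-(j : ℤ × ℤ).1) := by positivity
    simp only [U, Idy, interior_Icc, mem_Ioo] at hu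
    rw [Metric.mem_ball, Real.dist_eq, abs_lt] at *
    have : R * (2 : ℝ) ^ (-(j : ℤ × ℤ).1) ≤ R * 2 ^ (-(i : ℤ × ℤ).1) := by gcongr
    constructor <;> nlinarith
  calc ∑' j : N, ENNReal.ofReal (2 * c j)
      ≤ ∑' j : N, ENNReal.ofReal (4 * lam) * volume (U j) := ENNReal.tsum_le_tsum h1
    _ ≤ ENNReal.ofReal (4 * lam) * volume (Metric.ball
          ((2 : ℝ) ^ (-(i : ℤ × ℤ).1) * (i : ℤ × ℤ).2) (3 * (R * 2 ^ (-(i : ℤ × ℤ).1)))) := by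
      rw [ENNReal.tsum_mul_left]
      gcongr
      exact h3.trans (measure_mono h4)
    _ = _ := by
      rw [Real.volume_ball, ← ENNReal.ofReal_mul (by positivity)]
      ring_nf

theorem lintegral_tsum_ball_rpow_le {p : ℝ} (hp : 1 ≤ p) {n : ℕ} (hn : p ≤ n + 1)
    {R : ℝ} (hR : 1 ≤ R) {lam : ℝ} (hlam : 0 < lam) {S : Set (ℤ × ℤ)}
    (hS : S.Pairwise fun q q' =>
        Disjoint (interior (Idy q.1 q.2)) (interior (Idy q'.1 q'.2)))
    {c : ℤ × ℤ → ℝ} (hc : ∀ q ∈ S, 0 ≤ c q) (hc' : ∀ q ∈ S, (2 : ℝ) ^ q.1 * c q ≤ 2 * lam) :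
    ∫⁻ t, (∑' q : S, {t : ℝ | |(2 : ℝ) ^ (q : ℤ × ℤ).1 * t - (q : ℤ × ℤ).2| < R}.indicator
        (fun _ => ENNReal.ofReal ((2 : ℝ) ^ (q : ℤ × ℤ).1 * c q / R)) t) ^ p ≤
      (2 * (1 + (n + 1).factorial * 12 ^ n)) * ENNReal.ofReal lam ^ (p - 1) *
        ∑' q : S, ENNReal.ofReal (c q) := by
  have hR0 : 0 < R := by linarith
  simp_rw [setOf_abs_zpow_mul_sub_lt]
  set J : S → Set ℝ := fun q =>
    Metric.ball ((2 : ℝ) ^ (-(q : ℤ × ℤ).1) * (q : ℤ × ℤ).2) (R * 2 ^ (-(q : ℤ × ℤ).1)) with hJdef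
  set w : S → ℝ≥0∞ := fun q => ENNReal.ofReal ((2 : ℝ) ^ (q : ℤ × ℤ).1 * c q / R) with hwdef
  have hJ : ∀ q, MeasurableSet (J q) := fun q => measurableSet_ball
  have hc0 : ∀ q : S, 0 ≤ c q := fun q => hc q q.2
  have hpow : ∀ r : ℤ, (2 : ℝ) ^ r * 2 ^ (-r) = 1 := fun r => by
    rw [← zpow_add₀ two_ne_zero]; simp
  have hmom := fun k => lintegral_tsum_indicator_pow_le (μ := volume)
    (fun q : S => -(q : ℤ × ℤ).1) hJ (ENNReal.ofReal (12 * lam)) k w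
    (fun q => ENNReal.ofReal (2 * c q))
    (fun q => by
      rw [hJdef, hwdef]
      have := hc0 q
      simp only [Real.volume_ball]
      rw [← ENNReal.ofReal_mul (by positivity)]
      refine ENNReal.ofReal_le_ofReal (le_of_eq ?_)
      calc _ = 2 * c q * ((2 : ℝ) ^ (q : ℤ × ℤ).1 * 2 ^ (-(q : ℤ × ℤ).1)) * (R / R) := by ring
        _ = _ := by rw [hpow, div_self hR0.ne']; ring)
    (fun q => by
      have := hc0 q
      refine (mul_le_mul_right (tsum_coeff_neighbours_le hR hlam hS hc' q) _).trans ?_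
      rw [hwdef]
      simp only
      rw [← ENNReal.ofReal_mul (by positivity), ← ENNReal.ofReal_mul (by positivity)]
      refine ENNReal.ofReal_le_ofReal (le_of_eq ?_)
      calc _ = 24 * lam * c q * ((2 : ℝ) ^ (q : ℤ × ℤ).1 * 2 ^ (-(q : ℤ × ℤ).1)) * (R / R) := by
            ring
        _ = _ := by rw [hpow, div_self hR0.ne']; ring)
  have hl0 : ENNReal.ofReal lam ≠ 0 := by simpa using hlam
  have hlt : ENNReal.ofReal lam ≠ ∞ := ENNReal.ofReal_ne_top
  have hsum : ∑' q : S, ENNReal.ofReal (2 * c q) = 2 * ∑' q : S, ENNReal.ofReal (c q) := by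
    rw [← ENNReal.tsum_mul_left]
    simp_rw [ENNReal.ofReal_mul zero_le_two, ENNReal.ofReal_ofNat]
  have hmeas : Measurable fun t => ∑' q : S, (J q).indicator (fun _ => w q) t :=
    Measurable.tsum fun i => measurable_const.indicator (hJ i)
  have hm0 := hmom 0
  have hmn := hmom n
  rw [hsum] at hm0 hmn
  simp only [zero_add, pow_one, Nat.factorial_one, Nat.cast_one, pow_zero, one_mul] at hm0
  calc ∫⁻ t, (∑' q : S, (J q).indicator (fun _ => w q) t) ^ p
      ≤ ∫⁻ t, (ENNReal.ofReal lam ^ (p - 1) * (∑' q : S, (J q).indicator (fun _ => w q) t) +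
          ENNReal.ofReal lam ^ (p - (n + 1 : ℕ)) *
            (∑' q : S, (J q).indicator (fun _ => w q) t) ^ (n + 1)) :=
        lintegral_mono fun t =>
          ENNReal.rpow_le_mul_add_mul_pow hl0 hlt hp (by exact_mod_cast hn)
    _ = ENNReal.ofReal lam ^ (p - 1) * (∫⁻ t, ∑' q : S, (J q).indicator (fun _ => w q) t) +
          ENNReal.ofReal lam ^ (p - (n + 1 : ℕ)) *
            ∫⁻ t, (∑' q : S, (J q).indicator (fun _ => w q) t) ^ (n + 1) := by
        rw [lintegral_add_left (hmeas.const_mul _), lintegral_const_mul _ hmeas,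
          lintegral_const_mul _ (hmeas.pow_const _)]
    _ ≤ ENNReal.ofReal lam ^ (p - 1) * (2 * ∑' q : S, ENNReal.ofReal (c q)) +
          ENNReal.ofReal lam ^ (p - (n + 1 : ℕ)) *
            ((n + 1).factorial * ENNReal.ofReal (12 * lam) ^ n *
              (2 * ∑' q : S, ENNReal.ofReal (c q))) := by gcongr
    _ = _ := by
        have : ENNReal.ofReal lam ^ (p - 1) =
            ENNReal.ofReal lam ^ (p - (n + 1 : ℕ)) * ENNReal.ofReal lam ^ n := by
          rw [← ENNReal.rpow_natCast, ← ENNReal.rpow_add _ _ hl0 hlt]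
          congr 1
          push_cast
          ring
        rw [ENNReal.ofReal_mul (by norm_num), mul_pow, this, ENNReal.ofReal_ofNat]
        ring

/-- Coefficients of the decomposition of `β` into the functions `2 ^ (-k) 1_{|x| < 2 ^ k}`. -/
def dyadicCoeff (β : ℝ → ℝ) : ℕ → ℝ
  | 0 => β 0
  | k + 1 => 2 ^ (k + 1) * β (2 ^ k)

theorem dyadicCoeff_nonneg {β : ℝ → ℝ} (h0 : ∀ x, 0 ≤ β x) (k : ℕ) : 0 ≤ dyadicCoeff β k := by
  cases k with
  | zero => exact h0 0
  | succ k => exact mul_nonneg (by positivity) (h0 _)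

theorem exists_le_dyadicCoeff_div {β : ℝ → ℝ} (heven : ∀ x, β (-x) = β x)
    (hanti : AntitoneOn β (Ici 0)) (x : ℝ) :
    ∃ k : ℕ, |x| < 2 ^ k ∧ β x ≤ dyadicCoeff β k / 2 ^ k := by
  have habs : β x = β |x| := by
    rcases abs_choice x with h | h <;> simp [h, heven]
  have hex : ∃ k : ℕ, |x| < 2 ^ k := pow_unbounded_of_one_lt _ one_lt_two
  classical
  obtain ⟨k, hk⟩ : ∃ k, Nat.find hex = k := ⟨_, rfl⟩
  have hlt := Nat.find_spec hex
  rw [hk] at hlt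
  refine ⟨k, hlt, ?_⟩
  cases k with
  | zero =>
    rw [habs]
    simpa [dyadicCoeff] using hanti self_mem_Ici (abs_nonneg x) (abs_nonneg x)
  | succ k =>
    have hge : (2 : ℝ) ^ k ≤ |x| := not_lt.1 (Nat.find_min hex (by omega))
    rw [habs, dyadicCoeff, mul_div_cancel_left₀ _ (by positivity)]
    exact hanti (by simp) (abs_nonneg x) hge

theorem tsum_dyadicCoeff_ne_top {β : ℝ → ℝ} (hint : Integrable β)
    (hanti : AntitoneOn β (Ici 0)) :
    ∑' k, ENNReal.ofReal (dyadicCoeff β k) ≠ ∞ := by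
  set A : ℕ → Set ℝ := fun k => Ioo (2 ^ k / 2) (2 ^ k) with hA
  have hdisj : Pairwise (Function.onFun Disjoint A) := by
    refine (pairwise_disjoint_on A).2 fun j k hjk => ?_
    refine Set.disjoint_left.2 fun x hx hx' => ?_
    have : (2 : ℝ) ^ (j + 1) ≤ 2 ^ k := pow_le_pow_right₀ one_le_two hjk
    rw [pow_succ] at this
    linarith [hx.2, hx'.1]
  have hle : ∀ k, ENNReal.ofReal (dyadicCoeff β (k + 1)) ≤
      4 * ∫⁻ x in A k, ENNReal.ofReal (β x) := by
    intro k
    have h1 : ENNReal.ofReal (β (2 ^ k)) * volume (A k) ≤ ∫⁻ x in A k, ENNReal.ofReal (β x) := by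
      rw [← setLIntegral_const]
      refine setLIntegral_mono' measurableSet_Ioo fun x hx => ENNReal.ofReal_le_ofReal ?_
      have hpos : (0 : ℝ) < 2 ^ k := by positivity
      exact hanti (by simp only [mem_Ici]; linarith [hx.1]) hpos.le hx.2.le
    refine le_trans (le_of_eq ?_) (mul_le_mul_right h1 4)
    rw [hA, Real.volume_Ioo, dyadicCoeff, mul_comm (ENNReal.ofReal (β _)), ← mul_assoc,
      ← ENNReal.ofReal_ofNat 4, ← ENNReal.ofReal_mul (by norm_num), sub_half,
      ← ENNReal.ofReal_mul (by positivity)]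
    ring_nf
  have hfin : ∑' k, ENNReal.ofReal (dyadicCoeff β (k + 1)) < ∞ := by
    calc ∑' k, ENNReal.ofReal (dyadicCoeff β (k + 1))
        ≤ ∑' k, 4 * ∫⁻ x in A k, ENNReal.ofReal (β x) := ENNReal.tsum_le_tsum hle
      _ = 4 * ∫⁻ x in ⋃ k, A k, ENNReal.ofReal (β x) := by
        rw [ENNReal.tsum_mul_left, lintegral_iUnion (fun _ => measurableSet_Ioo) hdisj]
      _ ≤ 4 * ∫⁻ x, ENNReal.ofReal (β x) := by gcongr; exact Measure.restrict_le_self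
      _ < ∞ := ENNReal.mul_lt_top (by simp) hint.lintegral_lt_top
  rw [tsum_eq_zero_add' ENNReal.summable]
  exact (ENNReal.add_lt_top.2 ⟨ENNReal.ofReal_lt_top, hfin⟩).ne

/-- The `L^p` bound
`‖Σ_{(r,l) ∈ S} 2^r c_{rl} β(2^r · - l)‖_p ≤ C λ^{1-1/p} (Σ c_{rl})^{1/p}`, uniformly over all
families `S` of dyadic intervals with pairwise disjoint interiors, all nonnegative coefficients
`c_{rl}` with `2^r c_{rl} ≤ 2λ`, and all `λ > 0`. -/
theorem beta_sum_lp_bound (β : ℝ → ℝ) (hβ : BetaHyp β) (p : ℝ) (hp : 1 ≤ p) :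
    ∃ C > (0 : ℝ), ∀ lam > (0 : ℝ), ∀ S : Set (ℤ × ℤ),
      (S.Pairwise fun q q' =>
        Disjoint (interior (Idy q.1 q.2)) (interior (Idy q'.1 q'.2))) →
      ∀ c : ℤ × ℤ → ℝ, (∀ q ∈ S, 0 ≤ c q) →
      (∀ q ∈ S, (2 : ℝ) ^ q.1 * c q ≤ 2 * lam) →
      (∫⁻ t, (∑' (q : S), ENNReal.ofReal
            ((2 : ℝ) ^ (q : ℤ × ℤ).1 * c q *
              β ((2 : ℝ) ^ (q : ℤ × ℤ).1 * t - (q : ℤ × ℤ).2))) ^ p) ^ (1 / p) ≤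
        ENNReal.ofReal C * ENNReal.ofReal lam ^ (1 - 1 / p) *
          (∑' (q : S), ENNReal.ofReal (c q)) ^ (1 / p) := by
  obtain ⟨h0, -, heven, hint, hanti, -⟩ := hβ
  have hp0 : 0 < p := by linarith
  obtain ⟨n, hn⟩ := exists_nat_ge p
  set b : ℕ → ℝ≥0∞ := fun k => ENNReal.ofReal (dyadicCoeff β k) with hb
  set B := ∑' k, b k with hBdef
  have hB : B ≠ ∞ := tsum_dyadicCoeff_ne_top hint hanti
  set K : ℝ≥0∞ := 2 * (1 + (n + 1).factorial * 12 ^ n) with hK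
  have hKt : K ≠ ∞ := by finiteness
  set C₀ : ℝ≥0∞ := (B ^ (p - 1) * B * K) ^ (1 / p) with hC₀
  have hC₀t : C₀ ≠ ∞ := by
    have : 0 ≤ p - 1 := by linarith
    have : 0 ≤ 1 / p := by positivity
    finiteness
  refine ⟨C₀.toReal + 1, by positivity, fun lam hlam S hS c hc hc' => ?_⟩
  let F : ℕ → ℝ → ℝ≥0∞ := fun k t =>
    ∑' q : S, {t : ℝ | |(2 : ℝ) ^ (q : ℤ × ℤ).1 * t - (q : ℤ × ℤ).2| < 2 ^ k}.indicator
        (fun _ => ENNReal.ofReal ((2 : ℝ) ^ (q : ℤ × ℤ).1 * c q / 2 ^ k)) t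
  have hF : ∀ k, ∫⁻ t, F k t ^ p ≤ K * ENNReal.ofReal lam ^ (p - 1) *
      ∑' q : S, ENNReal.ofReal (c q) := fun k =>
    lintegral_tsum_ball_rpow_le hp (by linarith) (one_le_pow₀ one_le_two) hlam hS hc hc'
  have hFm : ∀ k, Measurable (F k) := fun k => Measurable.tsum fun q =>
    measurable_const.indicator (measurableSet_lt (by fun_prop) (by fun_prop))
  have hpt : ∀ t, (∑' (q : S), ENNReal.ofReal ((2 : ℝ) ^ (q : ℤ × ℤ).1 * c q *
      β ((2 : ℝ) ^ (q : ℤ × ℤ).1 * t - (q : ℤ × ℤ).2))) ≤ ∑' k, b k * F k t := by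
    intro t
    simp only [F, ← ENNReal.tsum_mul_left]
    rw [ENNReal.tsum_comm]
    refine ENNReal.tsum_le_tsum fun q => ?_
    obtain ⟨k, hk, hle⟩ := exists_le_dyadicCoeff_div heven hanti
      ((2 : ℝ) ^ (q : ℤ × ℤ).1 * t - (q : ℤ × ℤ).2)
    refine le_trans ?_ (ENNReal.le_tsum k)
    rw [indicator_of_mem (by exact hk), hb]
    simp only
    rw [← ENNReal.ofReal_mul (dyadicCoeff_nonneg h0 k)]
    apply ENNReal.ofReal_le_ofReal
    have hcq := hc q q.2
    calc _ ≤ (2 : ℝ) ^ (q : ℤ × ℤ).1 * c q * (dyadicCoeff β k / 2 ^ k) := by gcongr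
      _ = _ := by ring
  have hmain : ∫⁻ t, (∑' (q : S), ENNReal.ofReal ((2 : ℝ) ^ (q : ℤ × ℤ).1 * c q *
      β ((2 : ℝ) ^ (q : ℤ × ℤ).1 * t - (q : ℤ × ℤ).2))) ^ p ≤
      (B ^ (p - 1) * B * K) * ENNReal.ofReal lam ^ (p - 1) * ∑' q : S, ENNReal.ofReal (c q) := by
    calc _ ≤ ∫⁻ t, B ^ (p - 1) * ∑' k, b k * F k t ^ p := by
          refine lintegral_mono fun t => ?_
          exact (ENNReal.rpow_le_rpow (hpt t) hp0.le).trans (ENNReal.tsum_mul_rpow_le b _ hp)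
      _ = B ^ (p - 1) * ∑' k, b k * ∫⁻ t, F k t ^ p := by
          have hm : ∀ k, Measurable fun t => F k t ^ p := fun k => (hFm k).pow_const p
          rw [lintegral_const_mul _ (Measurable.tsum fun k => (hm k).const_mul _),
            lintegral_tsum fun k => ((hm k).const_mul _).aemeasurable]
          simp_rw [lintegral_const_mul _ (hm _)]
      _ ≤ B ^ (p - 1) * ∑' k, b k * (K * ENNReal.ofReal lam ^ (p - 1) *
            ∑' q : S, ENNReal.ofReal (c q)) := by
          gcongr with k
          exact hF k
      _ = _ := by rw [ENNReal.tsum_mul_right]; ring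
  calc _ ≤ ((B ^ (p - 1) * B * K) * ENNReal.ofReal lam ^ (p - 1) *
        ∑' q : S, ENNReal.ofReal (c q)) ^ (1 / p) := by gcongr
    _ = C₀ * ENNReal.ofReal lam ^ (1 - 1 / p) * (∑' q : S, ENNReal.ofReal (c q)) ^ (1 / p) := by
      have hp' : 0 ≤ 1 / p := by positivity
      rw [ENNReal.mul_rpow_of_nonneg _ _ hp', ENNReal.mul_rpow_of_nonneg _ _ hp',
        ← ENNReal.rpow_mul, sub_mul, mul_one_div_cancel hp0.ne', one_mul]
    _ ≤ _ := by
      gcongr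
      rw [ENNReal.le_ofReal_iff_toReal_le hC₀t (by positivity)]
      linarith

end
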